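/- arXiv:1912.07676 — 3 statements merged into one kernel-verified Lean document; each statement's English description precedes it below -/
import Mathlib

section
/- Under assumptions (A1)–(A8), there exists a unique element u ∈ K such that ⟨A u, v − u⟩ + φ(γ_φ u, γ_φ v) − φ(γ_φ u, γ_φ u) + j⁰(γ_j u; γ_j v − γ_j u) ≥ ⟨f, v − u⟩ for all v ∈ K. -/
open Filter Topology Bornology

/-- The generalized (Clarke) directional derivative of `ψ` at `x` in the direction `v`:
`ψ⁰(x; v) = limsup_{y → x, t ↓ 0} (ψ(y + t v) − ψ(y))/t`. -/
noncomputable def clarkeDeriv {Y : Type*} [NormedAddCommGroup Y] [NormedSpace ℝ Y]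
    (ψ : Y → ℝ) (x v : Y) : ℝ :=
  Filter.limsup (fun p : Y × ℝ => (ψ (p.1 + p.2 • v) - ψ p.1) / p.2)
    ((𝓝 x) ×ˢ (𝓝[>] (0 : ℝ)))

/-- The generalized (Clarke) subdifferential:
`∂ψ(x) = {ζ ∈ Y* : ψ⁰(x; v) ≥ ⟨ζ, v⟩ for all v ∈ Y}`. -/
def clarkeSubdiff {Y : Type*} [NormedAddCommGroup Y] [NormedSpace ℝ Y]
    (ψ : Y → ℝ) (x : Y) : Set (Y →L[ℝ] ℝ) :=
  {ζ | ∀ v : Y, ζ v ≤ clarkeDeriv ψ x v}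

/-- Weak convergence of a sequence in a normed space: `⟨g, uₙ⟩ → ⟨g, u⟩` for all `g ∈ Y*`. -/
def WeakTendsto {Y : Type*} [NormedAddCommGroup Y] [NormedSpace ℝ Y]
    (u : ℕ → Y) (w : Y) : Prop :=
  ∀ g : Y →L[ℝ] ℝ, Tendsto (fun n => g (u n)) atTop (𝓝 (g w))

/-- An operator `A : Y → Y*` is bounded if it maps bounded sets to bounded sets. -/
def BoundedOperator {Y : Type*} [NormedAddCommGroup Y] [NormedSpace ℝ Y]
    (A : Y → Y →L[ℝ] ℝ) : Prop :=
  ∀ s : Set Y, IsBounded s → IsBounded (A '' s)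

/-- `A : Y → Y*` is pseudomonotone: it is bounded, and whenever `uₙ ⇀ u` weakly and
`limsupₙ ⟨A uₙ, uₙ − u⟩ ≤ 0`, one has
`⟨A u, u − v⟩ ≤ liminfₙ ⟨A uₙ, uₙ − v⟩` for all `v`. -/
def Pseudomonotone {Y : Type*} [NormedAddCommGroup Y] [NormedSpace ℝ Y]
    (A : Y → Y →L[ℝ] ℝ) : Prop :=
  BoundedOperator A ∧
  ∀ (u : ℕ → Y) (w : Y), WeakTendsto u w →
    Filter.limsup (fun n => A (u n) (u n - w)) atTop ≤ 0 →
    ∀ v : Y, A w (w - v) ≤ Filter.liminf (fun n => A (u n) (u n - v)) atTop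

/-- `P : Y → Y*` is a penalty operator for the set `K`: `P` is bounded, demicontinuous,
monotone, and `Ker(P) = K`. -/
def IsPenaltyOperator {Y : Type*} [NormedAddCommGroup Y] [NormedSpace ℝ Y]
    (P : Y → Y →L[ℝ] ℝ) (K : Set Y) : Prop :=
  BoundedOperator P ∧
  (∀ (u : ℕ → Y) (w : Y), Tendsto u atTop (𝓝 w) →
    ∀ v : Y, Tendsto (fun n => P (u n) v) atTop (𝓝 (P w v))) ∧
  (∀ v₁ v₂ : Y, 0 ≤ (P v₁ - P v₂) (v₁ - v₂)) ∧
  {v : Y | P v = 0} = K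

/-- A real normed space is reflexive if the canonical embedding into the double dual
is surjective. -/
def IsReflexive (Y : Type*) [NormedAddCommGroup Y] [NormedSpace ℝ Y] : Prop :=
  Function.Surjective (NormedSpace.inclusionInDoubleDual ℝ Y)

/-- In a reflexive space, a family of closed convex sets, one of which is bounded, has a common
point as soon as its finite subfamilies have. -/
theorem IsReflexive.nonempty_iInter {X ι : Type*} [NormedAddCommGroup X] [NormedSpace ℝ X]
    (hX : IsReflexive X) {S : ι → Set X} (hcl : ∀ i, IsClosed (S i))
    (hcv : ∀ i, Convex ℝ (S i)) {i₀ : ι} (hbd : IsBounded (S i₀))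
    (hfin : ∀ t : Finset ι, (⋂ i ∈ t, S i).Nonempty) : (⋂ i, S i).Nonempty := by
  classical
  obtain ⟨R, hR⟩ := hbd.subset_closedBall 0
  let g : WeakDual ℝ (StrongDual ℝ X) → WeakSpace ℝ X :=
    fun z => toWeakSpace ℝ X (Function.surjInv hX (WeakDual.toStrongDual z))
  have hgz (z : WeakDual ℝ (StrongDual ℝ X)) (x : StrongDual ℝ X) :
      x (Function.surjInv hX (WeakDual.toStrongDual z)) = z x := by
    have := Function.surjInv_eq hX (WeakDual.toStrongDual z)
    simpa using DFunLike.congr_fun this x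
  have hgc : Continuous g := by
    refine WeakBilin.continuous_of_continuous_eval _ fun x => ?_
    have : (fun z => x (Function.surjInv hX (WeakDual.toStrongDual z))) =
        fun z : WeakDual ℝ (StrongDual ℝ X) => z x := funext fun z => hgz z x
    exact this ▸ WeakDual.eval_continuous x
  have hcomp := (WeakDual.isCompact_closedBall (𝕜 := ℝ) (0 : StrongDual ℝ (StrongDual ℝ X)) R).image
    hgc
  have hsub (x : X) (hx : x ∈ S i₀) : toWeakSpace ℝ X x ∈
      g '' (WeakDual.toStrongDual ⁻¹' Metric.closedBall
        (0 : StrongDual ℝ (StrongDual ℝ X)) R) := by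
    refine ⟨StrongDual.toWeakDual (NormedSpace.inclusionInDoubleDual ℝ X x), ?_, ?_⟩
    · have h1 : ‖x‖ ≤ R := mem_closedBall_zero_iff.1 (hR hx)
      have h2 : ‖NormedSpace.inclusionInDoubleDual ℝ X x‖ ≤ R :=
        (NormedSpace.double_dual_bound ℝ X x).trans h1
      exact (dist_zero_right (NormedSpace.inclusionInDoubleDual ℝ X x)).trans_le h2
    · have hinj : Function.Injective (NormedSpace.inclusionInDoubleDual ℝ X) :=
        (NormedSpace.inclusionInDoubleDualLi ℝ (E := X)).injective
      exact congrArg (toWeakSpace ℝ X) (hinj (Function.surjInv_eq hX _))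
  have hclw (i) : IsClosed (toWeakSpace ℝ X '' S i) := by
    have h := (hcv i).toWeakSpace_closure ℝ
    rw [(hcl i).closure_eq] at h
    exact h ▸ isClosed_closure
  obtain ⟨w, -, hw⟩ := hcomp.inter_iInter_nonempty (fun i => toWeakSpace ℝ X '' S i) hclw
    fun t => by
      obtain ⟨x, hx⟩ := hfin (insert i₀ t)
      simp only [Finset.mem_insert, Set.mem_iInter] at hx
      refine ⟨toWeakSpace ℝ X x, hsub x (hx i₀ (Or.inl rfl)), ?_⟩
      simp only [Set.mem_iInter]
      exact fun i hi => ⟨x, hx i (Or.inr hi), rfl⟩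
  simp only [Set.mem_iInter] at hw
  refine ⟨(toWeakSpace ℝ X).symm w, Set.mem_iInter.2 fun i => ?_⟩
  obtain ⟨x, hx, rfl⟩ := hw i
  simpa using hx

/-- A monotone bifunction, convex and lower semicontinuous in its second argument, has a common
nonpositivity point in the convex hull of any finite nonempty family. -/
theorem exists_mem_convexHull_forall_le_zero {X ι : Type*} [NormedAddCommGroup X]
    [NormedSpace ℝ X] [Fintype ι] [Nonempty ι] (F : X → X → ℝ)
    (hcv : ∀ v, ConvexOn ℝ Set.univ (F v)) (hlsc : ∀ v, LowerSemicontinuous (F v))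
    (hmono : ∀ u v, F u v + F v u ≤ 0) (v : ι → X) :
    ∃ u ∈ convexHull ℝ (Set.range v), ∀ i, F (v i) u ≤ 0 := by
  classical
  set c : (ι → ℝ) →ₗ[ℝ] X := Fintype.linearCombination ℝ v
  have hcc : Continuous c := c.continuous_of_finiteDimensional
  have hne : (stdSimplex ℝ ι).Nonempty :=
    ⟨Pi.single (Classical.arbitrary ι) 1, single_mem_stdSimplex ℝ _⟩
  obtain ⟨a, ha, b, hb, hab⟩ := Sion.exists_isSaddlePointOn
    (X := stdSimplex ℝ ι) (Y := stdSimplex ℝ ι) (f := fun l m => ∑ i, m i * F (v i) (c l))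
    hne (convex_stdSimplex ℝ ι) (isCompact_stdSimplex ℝ ι)
    (fun m hm => LowerSemicontinuous.lowerSemicontinuousOn
      (lowerSemicontinuous_sum fun i _ =>
        (continuous_const_mul (m i)).comp_lowerSemicontinuous
          ((hlsc (v i)).comp hcc) (monotone_mul_left_of_nonneg (hm.1 i))) _)
    (fun m hm => ConvexOn.quasiconvexOn (by
      refine ⟨convex_stdSimplex ℝ ι, fun x _ y _ s t hs ht hst => ?_⟩
      simp only [smul_eq_mul, Finset.mul_sum, ← Finset.sum_add_distrib, map_add, map_smul]
      refine Finset.sum_le_sum fun i _ => ?_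
      have h := (hcv (v i)).2 (Set.mem_univ (c x)) (Set.mem_univ (c y)) hs ht hst
      simp only [smul_eq_mul] at h
      nlinarith [mul_le_mul_of_nonneg_left h (hm.1 i)]))
    (convex_stdSimplex ℝ ι) hne (isCompact_stdSimplex ℝ ι)
    (fun l _ => (Continuous.upperSemicontinuous (by fun_prop)).upperSemicontinuousOn _)
    (fun l _ => ConcaveOn.quasiconcaveOn (by
      refine ⟨convex_stdSimplex ℝ ι, fun x _ y _ s t hs ht hst => ?_⟩
      simp only [smul_eq_mul, Finset.mul_sum, ← Finset.sum_add_distrib, Pi.add_apply,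
        Pi.smul_apply]
      exact Finset.sum_le_sum fun i _ => le_of_eq (by ring)))
  have hcap (l : ι → ℝ) : c l = ∑ i, l i • v i := Fintype.linearCombination_apply ..
  have hbb : ∑ i, b i * F (v i) (c b) ≤ 0 := by
    have h1 : ∑ i, b i * F (v i) (c b) ≤ ∑ i, ∑ k, b i * b k * F (v i) (v k) := by
      refine Finset.sum_le_sum fun i _ => ?_
      have h := (hcv (v i)).map_sum_le (t := Finset.univ) (w := b) (p := v)
        (fun k _ => hb.1 k) hb.2 (fun _ _ => Set.mem_univ _)
      rw [hcap]
      refine (mul_le_mul_of_nonneg_left h (hb.1 i)).trans_eq ?_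
      simp only [smul_eq_mul, Finset.mul_sum, mul_assoc]
    have h2 : ∑ i, ∑ k, b i * b k * F (v i) (v k) = ∑ i, ∑ k, b i * b k * F (v k) (v i) := by
      rw [Finset.sum_comm]
      simp only [mul_comm]
    have h3 : ∑ i, ∑ k, b i * b k * F (v i) (v k) + ∑ i, ∑ k, b i * b k * F (v k) (v i) ≤ 0 := by
      simp only [← Finset.sum_add_distrib, ← mul_add]
      exact Finset.sum_nonpos fun i _ => Finset.sum_nonpos fun k _ =>
        mul_nonpos_of_nonneg_of_nonpos (mul_nonneg (hb.1 i) (hb.1 k)) (hmono _ _)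
    linarith
  refine ⟨c a, ?_, fun i => ?_⟩
  · rw [hcap]
    exact (convex_convexHull ℝ _).sum_mem (fun i _ => ha.1 i) ha.2
      fun i _ => subset_convexHull ℝ _ ⟨i, rfl⟩
  · have h := hab b hb (Pi.single i 1) (single_mem_stdSimplex ℝ i)
    simp only [Pi.single_apply, ite_mul, one_mul, zero_mul, Finset.sum_ite_eq', Finset.mem_univ,
      if_true] at h
    exact h.trans hbb

/-- A convex function that is lower semicontinuous at a point decreases at most linearly away
from it. -/
theorem ConvexOn.exists_neg_le_sub {X : Type*} [NormedAddCommGroup X] [NormedSpace ℝ X]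
    {G : X → ℝ} (hG : ConvexOn ℝ Set.univ G) {v : X} (hv : LowerSemicontinuousAt G v) :
    ∃ C : ℝ, ∀ u, -(1 + C * ‖u - v‖) ≤ G u - G v := by
  obtain ⟨δ, hδ, h⟩ := Metric.eventually_nhds_iff.1 (hv (G v - 1) (by linarith))
  refine ⟨2 / δ, fun u => ?_⟩
  by_cases hu : ‖u - v‖ < δ
  · have := h (y := u) (by rwa [dist_eq_norm])
    have : 0 ≤ 2 / δ * ‖u - v‖ := by positivity
    linarith
  · push Not at hu
    have hpos : 0 < ‖u - v‖ := hδ.trans_le hu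
    set s : ℝ := δ / (2 * ‖u - v‖) with hs
    have hs0 : 0 < s := by positivity
    have hs1 : s ≤ 1 := by rw [hs, div_le_one (by positivity)]; linarith
    have h1 := hG.2 (Set.mem_univ v) (Set.mem_univ u) (sub_nonneg.2 hs1) hs0.le (by ring)
    have h2 := h (y := (1 - s) • v + s • u) (by
      rw [dist_eq_norm, show (1 - s) • v + s • u - v = s • (u - v) by module, norm_smul,
        Real.norm_of_nonneg hs0.le, hs]
      field_simp
      linarith)
    simp only [smul_eq_mul] at h1
    have h3 : -1 ≤ s * (G u - G v) := by linarith
    have h4 : s * (2 / δ * ‖u - v‖) = 1 := by rw [hs]; field_simp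
    have h5 : s * (-(2 / δ * ‖u - v‖)) ≤ s * (G u - G v) := by linarith
    have h6 := le_of_mul_le_mul_left h5 hs0
    linarith

/-- A strongly monotone equilibrium problem on a closed convex subset of a reflexive space has a
unique solution. -/
theorem IsReflexive.existsUnique_equilibrium {X : Type*} [NormedAddCommGroup X]
    [NormedSpace ℝ X] (hX : IsReflexive X) {K : Set X} (hKne : K.Nonempty) (hKcl : IsClosed K)
    (hKcv : Convex ℝ K) (F : X → X → ℝ) (hself : ∀ v, F v v = 0)
    (hcv : ∀ v, ConvexOn ℝ Set.univ (F v)) (hlsc : ∀ v, LowerSemicontinuous (F v))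
    (husc : ∀ v, UpperSemicontinuous fun u => F u v) {m : ℝ} (hm : 0 < m)
    (hmono : ∀ u v, F u v + F v u ≤ -(m * ‖u - v‖ ^ 2)) :
    ∃! u : X, u ∈ K ∧ ∀ v ∈ K, 0 ≤ F u v := by
  set G : X → X → ℝ := fun v u => F v u + m / 2 * ‖u - v‖ ^ 2 with hG
  have hGmono (u v) : G u v + G v u ≤ 0 := by
    have := hmono u v
    simp only [hG, norm_sub_rev v u]
    linarith
  have hGcv (v) : ConvexOn ℝ Set.univ (G v) := by
    refine (hcv v).add (ConvexOn.smul (by positivity : 0 ≤ m / 2) ?_)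
    refine ConvexOn.pow ?_ (fun _ _ => norm_nonneg _) 2
    simpa [dist_eq_norm] using convexOn_dist v (convex_univ (𝕜 := ℝ) (E := X))
  have hGlsc (v) : LowerSemicontinuous (G v) :=
    (hlsc v).add (Continuous.lowerSemicontinuous (by fun_prop))
  have hGbd (v) : IsBounded {u | G v u ≤ 0} := by
    obtain ⟨C, hC⟩ := (hcv v).exists_neg_le_sub (hlsc v v)
    refine (Metric.isBounded_closedBall (x := v) (r := 1 + 2 * (1 + |C|) / m)).subset fun u hu => ?_
    have h1 := hC u
    simp only [hG, Set.mem_ofPred_eq] at hu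
    rw [hself] at h1
    rw [Metric.mem_closedBall, dist_eq_norm]
    by_contra! hlt
    set r := ‖u - v‖
    have hr1 : 1 < r := by have : 0 ≤ 2 * (1 + |C|) / m := by positivity
                           linarith
    have h2 : 2 * (1 + |C|) / m < r := by linarith
    rw [div_lt_iff₀ hm] at h2
    nlinarith [le_abs_self C, abs_nonneg C]
  have hne : Nonempty K := hKne.to_subtype
  obtain ⟨u, hu⟩ := hX.nonempty_iInter (S := fun v : K => K ∩ {u | G v u ≤ 0})
    (fun v => hKcl.inter ((hGlsc v).isClosed_preimage 0))
    (fun v => hKcv.inter (by simpa using (hGcv v).convex_le 0))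
    (i₀ := Classical.arbitrary K) ((hGbd _).subset Set.inter_subset_right) (fun t => by
      rcases t.eq_empty_or_nonempty with rfl | ht
      · simp
      have : Nonempty t := ht.to_subtype
      obtain ⟨u, hu, hu'⟩ := exists_mem_convexHull_forall_le_zero G hGcv hGlsc hGmono
        fun i : t => (i : X)
      refine ⟨u, Set.mem_iInter₂.2 fun v hv => ⟨convexHull_min ?_ hKcv hu, hu' ⟨v, hv⟩⟩⟩
      rintro _ ⟨i, rfl⟩
      exact i.1.2)
  simp only [Set.mem_iInter, Set.mem_inter_iff, Set.mem_ofPred_eq, Subtype.forall] at hu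
  have huK : u ∈ K := (hu _ hKne.some_mem).1
  have hF (v) (hv : v ∈ K) : F v u ≤ 0 := by
    have h1 := (hu v hv).2
    have : 0 ≤ m / 2 * ‖u - v‖ ^ 2 := by positivity
    simp only [hG] at h1
    linarith
  refine ⟨u, ⟨huK, fun v hv => ?_⟩, fun w hw => ?_⟩
  · by_contra! hlt
    have hc : Tendsto (fun t : ℝ => (1 - t) • u + t • v) (𝓝[>] 0) (𝓝 u) := by
      have : Continuous fun t : ℝ => (1 - t) • u + t • v := by fun_prop
      simpa using (this.tendsto 0).mono_left nhdsWithin_le_nhds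
    have h1 := hc.eventually (husc v u 0 hlt)
    obtain ⟨t, ht, ht0, ht1⟩ := (h1.and (Ioo_mem_nhdsGT (zero_lt_one (α := ℝ)))).exists
    set w := (1 - t) • u + t • v
    have hwK : w ∈ K := hKcv huK hv (by linarith) ht0.le (by ring)
    have h2 := (hcv w).2 (Set.mem_univ u) (Set.mem_univ v) (sub_nonneg.2 ht1.le) ht0.le (by ring)
    rw [hself] at h2
    simp only [smul_eq_mul] at h2
    nlinarith [hF w hwK, mul_neg_of_pos_of_neg ht0 ht]
  · have h1 := hmono u w
    have h2 := hF w hw.1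
    have h3 := hw.2 u huK
    have h4 := (hu w hw.1).2
    simp only [hG] at h4
    have h5 : m / 2 * ‖u - w‖ ^ 2 ≤ 0 := by linarith
    have h6 : ‖u - w‖ ^ 2 ≤ 0 := by nlinarith
    have h7 : ‖u - w‖ = 0 := by nlinarith [norm_nonneg (u - w)]
    exact (sub_eq_zero.1 (norm_eq_zero.1 h7)).symm

theorem eventually_pos_snd {Y : Type*} [TopologicalSpace Y] (x : Y) :
    ∀ᶠ p : Y × ℝ in 𝓝 x ×ˢ 𝓝[>] (0 : ℝ), 0 < p.2 :=
  tendsto_snd.eventually self_mem_nhdsWithin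

section Clarke

variable {Y : Type*} [NormedAddCommGroup Y] [NormedSpace ℝ Y] {ψ : Y → ℝ}

theorem tendsto_add_smul_nhdsGT (x v : Y) :
    Tendsto (fun p : Y × ℝ => p.1 + p.2 • v) (𝓝 x ×ˢ 𝓝[>] (0 : ℝ)) (𝓝 x) := by
  have h : Continuous fun p : Y × ℝ => p.1 + p.2 • v := by fun_prop
  have h' := h.tendsto (x, 0)
  rw [nhds_prod_eq] at h'
  simpa using h'.mono_left (prod_mono le_rfl nhdsWithin_le_nhds)

/-- Near a point, the difference quotients of a locally Lipschitz function are uniformly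
bounded. -/
theorem LocallyLipschitz.exists_eventually_abs_quotient_le (hψ : LocallyLipschitz ψ) (x : Y) :
    ∃ L : ℝ, ∀ᶠ y in 𝓝 x, ∀ v : Y, ∀ᶠ p : Y × ℝ in 𝓝 y ×ˢ 𝓝[>] (0 : ℝ),
      |(ψ (p.1 + p.2 • v) - ψ p.1) / p.2| ≤ L * ‖v‖ := by
  obtain ⟨L, s, hs, hL⟩ := hψ x
  refine ⟨L, ?_⟩
  filter_upwards [eventually_eventually_nhds.2 hs] with y hy v
  filter_upwards [tendsto_fst.eventually hy, (tendsto_add_smul_nhdsGT y v).eventually hy,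
    eventually_pos_snd y] with p h1 h2 h3
  have h := hL.dist_le_mul _ h2 _ h1
  rw [Real.dist_eq, dist_eq_norm, add_sub_cancel_left, norm_smul, Real.norm_of_nonneg h3.le] at h
  rw [abs_div, abs_of_pos h3, div_le_iff₀ h3]
  linarith

theorem LocallyLipschitz.exists_abs_quotient_le (hψ : LocallyLipschitz ψ) (x v : Y) :
    ∃ L : ℝ, ∀ᶠ p : Y × ℝ in 𝓝 x ×ˢ 𝓝[>] (0 : ℝ),
      |(ψ (p.1 + p.2 • v) - ψ p.1) / p.2| ≤ L :=
  let ⟨L, hL⟩ := hψ.exists_eventually_abs_quotient_le x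
  ⟨L * ‖v‖, hL.self_of_nhds v⟩

theorem LocallyLipschitz.clarkeDeriv_le (hψ : LocallyLipschitz ψ) {x v : Y} {a : ℝ}
    (h : ∀ᶠ p : Y × ℝ in 𝓝 x ×ˢ 𝓝[>] (0 : ℝ), (ψ (p.1 + p.2 • v) - ψ p.1) / p.2 ≤ a) :
    clarkeDeriv ψ x v ≤ a := by
  obtain ⟨L, hL⟩ := hψ.exists_abs_quotient_le x v
  exact limsup_le_of_le (IsBoundedUnder.isCoboundedUnder_le
    ⟨-L, eventually_map.2 (hL.mono fun _ hp => (abs_le.1 hp).1)⟩) h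

theorem LocallyLipschitz.eventually_quotient_lt (hψ : LocallyLipschitz ψ) {x v : Y} {a : ℝ}
    (h : clarkeDeriv ψ x v < a) :
    ∀ᶠ p : Y × ℝ in 𝓝 x ×ˢ 𝓝[>] (0 : ℝ), (ψ (p.1 + p.2 • v) - ψ p.1) / p.2 < a := by
  obtain ⟨L, hL⟩ := hψ.exists_abs_quotient_le x v
  exact eventually_lt_of_limsup_lt h
    ⟨L, eventually_map.2 (hL.mono fun _ hp => (abs_le.1 hp).2)⟩

theorem clarkeDeriv_zero_right (ψ : Y → ℝ) (x : Y) : clarkeDeriv ψ x 0 = 0 := by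
  simp [clarkeDeriv]

theorem LocallyLipschitz.exists_eventually_clarkeDeriv_le (hψ : LocallyLipschitz ψ) (x : Y) :
    ∃ L : ℝ, ∀ᶠ y in 𝓝 x, ∀ v : Y, clarkeDeriv ψ y v ≤ L * ‖v‖ :=
  let ⟨L, hL⟩ := hψ.exists_eventually_abs_quotient_le x
  ⟨L, hL.mono fun _ hy v => hψ.clarkeDeriv_le ((hy v).mono fun _ hp => (abs_le.1 hp).2)⟩

theorem LocallyLipschitz.clarkeDeriv_add_le (hψ : LocallyLipschitz ψ) (x v w : Y) :
    clarkeDeriv ψ x (v + w) ≤ clarkeDeriv ψ x v + clarkeDeriv ψ x w := by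
  refine le_of_forall_pos_lt_add fun ε hε => ?_
  have ht : Tendsto (fun p : Y × ℝ => (p.1 + p.2 • w, p.2)) (𝓝 x ×ˢ 𝓝[>] (0 : ℝ))
      (𝓝 x ×ˢ 𝓝[>] (0 : ℝ)) := (tendsto_add_smul_nhdsGT x w).prodMk tendsto_snd
  have h1 := ht.eventually (hψ.eventually_quotient_lt
    (lt_add_of_pos_right (clarkeDeriv ψ x v) (show 0 < ε / 3 by positivity)))
  have h2 := hψ.eventually_quotient_lt
    (lt_add_of_pos_right (clarkeDeriv ψ x w) (show 0 < ε / 3 by positivity))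
  refine (hψ.clarkeDeriv_le (a := clarkeDeriv ψ x v + clarkeDeriv ψ x w + ε / 3 + ε / 3)
    ?_).trans_lt (by linarith)
  filter_upwards [h1, h2] with p h1 h2
  rw [show p.1 + p.2 • (v + w) = p.1 + p.2 • w + p.2 • v by module,
    ← sub_add_sub_cancel _ (ψ (p.1 + p.2 • w)), add_div]
  linarith

theorem LocallyLipschitz.clarkeDeriv_smul_le (hψ : LocallyLipschitz ψ) (x v : Y) {c : ℝ}
    (hc : 0 ≤ c) : clarkeDeriv ψ x (c • v) ≤ c * clarkeDeriv ψ x v := by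
  rcases hc.eq_or_lt with rfl | hc
  · simp [clarkeDeriv_zero_right]
  refine le_of_forall_gt_imp_ge_of_dense fun b hb => hψ.clarkeDeriv_le ?_
  have h1 : clarkeDeriv ψ x v < b / c := by rwa [lt_div_iff₀ hc, mul_comm]
  have hm : Tendsto (fun t : ℝ => c * t) (𝓝[>] 0) (𝓝[>] 0) := by
    refine tendsto_nhdsWithin_iff.2 ⟨?_, ?_⟩
    · have : Continuous fun t : ℝ => c * t := by fun_prop
      simpa using (this.tendsto 0).mono_left nhdsWithin_le_nhds
    · filter_upwards [self_mem_nhdsWithin] with t ht using mul_pos hc ht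
  have ht : Tendsto (fun p : Y × ℝ => (p.1, c * p.2)) (𝓝 x ×ˢ 𝓝[>] (0 : ℝ))
      (𝓝 x ×ˢ 𝓝[>] (0 : ℝ)) := tendsto_fst.prodMk (hm.comp tendsto_snd)
  filter_upwards [ht.eventually (hψ.eventually_quotient_lt h1), eventually_pos_snd x] with p h2 h3
  rw [div_lt_div_iff₀ (mul_pos hc h3) hc] at h2
  rw [smul_smul, mul_comm p.2 c, div_le_iff₀ h3]
  nlinarith

theorem LocallyLipschitz.convexOn_clarkeDeriv (hψ : LocallyLipschitz ψ) (x : Y) :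
    ConvexOn ℝ Set.univ (clarkeDeriv ψ x) :=
  ⟨convex_univ, fun v _ w _ _ _ ha hb _ => (hψ.clarkeDeriv_add_le x _ _).trans
    (add_le_add (hψ.clarkeDeriv_smul_le x v ha) (hψ.clarkeDeriv_smul_le x w hb))⟩

theorem LocallyLipschitz.continuous_clarkeDeriv (hψ : LocallyLipschitz ψ) (x : Y) :
    Continuous (clarkeDeriv ψ x) := by
  obtain ⟨L, hL⟩ := hψ.exists_eventually_clarkeDeriv_le x
  refine (LipschitzWith.of_le_add_mul L.toNNReal fun v w => ?_).continuous
  have h1 := hψ.clarkeDeriv_add_le x w (v - w)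
  rw [add_sub_cancel] at h1
  have h2 := hL.self_of_nhds (v - w)
  rw [dist_eq_norm]
  nlinarith [Real.le_coe_toNNReal L, norm_nonneg (v - w)]

theorem LocallyLipschitz.upperSemicontinuous_clarkeDeriv (hψ : LocallyLipschitz ψ) :
    UpperSemicontinuous fun p : Y × Y => clarkeDeriv ψ p.1 p.2 := by
  rintro ⟨x, v⟩ a ha
  obtain ⟨b, hb, hba⟩ := exists_between (show clarkeDeriv ψ x v < a from ha)
  obtain ⟨L, hL⟩ := hψ.exists_eventually_clarkeDeriv_le x
  have h1 : ∀ᶠ y in 𝓝 x, clarkeDeriv ψ y v ≤ b := by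
    obtain ⟨s, hs, t, ht, hst⟩ := mem_prod_iff.1 (hψ.eventually_quotient_lt hb)
    filter_upwards [eventually_mem_nhds_iff.2 hs] with y hy
    exact hψ.clarkeDeriv_le (mem_of_superset (prod_mem_prod hy ht) fun p hp => le_of_lt (b := b) (hst hp))
  have h2 : ∀ᶠ w in 𝓝 v, L * ‖w - v‖ < a - b := by
    have : Continuous fun w => L * ‖w - v‖ := by fun_prop
    exact (this.tendsto v).eventually_lt_const (by simpa using hba)
  rw [nhds_prod_eq]
  filter_upwards [(h1.and hL).prod_mk h2] with p ⟨⟨h3, h4⟩, h5⟩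
  have h6 := hψ.clarkeDeriv_add_le p.1 v (p.2 - v)
  rw [add_sub_cancel] at h6
  linarith [h4 (p.2 - v)]

end Clarke

/-- A pseudomonotone operator satisfies the upper semicontinuity in the norm topology required of
an equilibrium bifunction. -/
theorem Pseudomonotone.upperSemicontinuous_apply_sub {X : Type*} [NormedAddCommGroup X]
    [NormedSpace ℝ X] {A : X → X →L[ℝ] ℝ} (hA : Pseudomonotone A) (v : X) :
    UpperSemicontinuous fun u => A u (v - u) := by
  intro w a ha
  refine eventually_iff_seq_eventually.2 fun u hu => ?_
  obtain ⟨C, hC⟩ := (hA.1 _ (Metric.isBounded_range_of_tendsto u hu)).exists_norm_le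
  have hAu (n) : ‖A (u n)‖ ≤ C := hC _ ⟨_, ⟨n, rfl⟩, rfl⟩
  have hbound (x : X) (n) : |A (u n) (u n - x)| ≤ C * ‖u n - x‖ :=
    ((A (u n)).le_opNorm _).trans (mul_le_mul_of_nonneg_right (hAu n) (norm_nonneg _))
  have hlim (x : X) : Tendsto (fun n => C * ‖u n - x‖) atTop (𝓝 (C * ‖w - x‖)) :=
    ((hu.sub_const x).norm).const_mul C
  have h0 : Tendsto (fun n => A (u n) (u n - w)) atTop (𝓝 0) :=
    squeeze_zero_norm (hbound w) (by simpa using hlim w)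
  have h1 := hA.2 u w (fun g => (g.continuous.tendsto w).comp hu) h0.limsup_eq.le v
  obtain ⟨B, hB⟩ := (hlim v).bddAbove_range
  have h2 : -a < A w (w - v) := by
    have : A w (v - w) = -A w (w - v) := by rw [← map_neg, neg_sub]
    have : A w (v - w) < a := ha
    linarith
  have h3 := eventually_lt_of_lt_liminf (h2.trans_le h1)
    ⟨-B, eventually_map.2 (Eventually.of_forall fun n => by
      have := abs_le.1 ((hbound v n).trans (hB ⟨n, rfl⟩))
      exact this.1)⟩
  filter_upwards [h3] with n hn
  have : A (u n) (v - u n) = -A (u n) (u n - v) := by rw [← map_neg, neg_sub]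
  show A (u n) (v - u n) < a
  linarith

/-- The variational part `φ(z, w) - φ(z, z)` is upper semicontinuous in `z`. -/
theorem upperSemicontinuous_sub_diag {Z : Type*} [NormedAddCommGroup Z] {φ : Z → Z → ℝ} {α : ℝ}
    (hlsc : ∀ z, LowerSemicontinuous (φ z))
    (hφ : ∀ z₁ z₂ z₃ z₄ : Z,
      φ z₁ z₄ - φ z₁ z₃ + φ z₂ z₃ - φ z₂ z₄ ≤ α * ‖z₁ - z₂‖ * ‖z₃ - z₄‖) (w : Z) :
    UpperSemicontinuous fun z => φ z w - φ z z := by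
  intro z a ha
  have ha' : φ z w - φ z z < a := ha
  have h1 := hlsc z z (φ z z - (a - (φ z w - φ z z)) / 2) (by linarith)
  have h2 : ∀ᶠ y in 𝓝 z, α * ‖y - z‖ * ‖y - w‖ < (a - (φ z w - φ z z)) / 2 := by
    have : Continuous fun y => α * ‖y - z‖ * ‖y - w‖ := by fun_prop
    exact (this.tendsto z).eventually_lt_const (by simpa using ha')
  filter_upwards [h1, h2] with y h3 h4
  have := hφ y z y w
  show φ y w - φ y y < a
  linarith

/-- Theorem 1: under (A1)–(A8) the constrained
variational-hemivariational inequality has a unique solution `u ∈ K`. -/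
theorem vhvi_exists_unique
    {X Xφ Xj : Type*}
    [NormedAddCommGroup X] [NormedSpace ℝ X] [CompleteSpace X]
    [NormedAddCommGroup Xφ] [NormedSpace ℝ Xφ] [CompleteSpace Xφ]
    [NormedAddCommGroup Xj] [NormedSpace ℝ Xj] [CompleteSpace Xj]
    -- (A1)
    (hrefl : IsReflexive X)
    (K : Set X) (hKne : K.Nonempty) (hKcl : IsClosed K) (hKcv : Convex ℝ K)
    -- (A2)
    (γφ : X →L[ℝ] Xφ) (cφ : ℝ) (hcφ : 0 < cφ) (hγφ : ∀ v : X, ‖γφ v‖ ≤ cφ * ‖v‖)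
    -- (A3)
    (γj : X →L[ℝ] Xj) (cj : ℝ) (hcj : 0 < cj) (hγj : ∀ v : X, ‖γj v‖ ≤ cj * ‖v‖)
    -- (A4)
    (A : X → X →L[ℝ] ℝ) (hA : Pseudomonotone A)
    (mA : ℝ) (hmA : 0 < mA)
    (hAsm : ∀ v₁ v₂ : X, mA * ‖v₁ - v₂‖ ^ 2 ≤ (A v₁ - A v₂) (v₁ - v₂))
    -- (A5)
    (φ : Xφ → Xφ → ℝ)
    (hφcv : ∀ z : Xφ, ConvexOn ℝ Set.univ (φ z))
    (hφlsc : ∀ z : Xφ, LowerSemicontinuous (φ z))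
    (αφ : ℝ) (hαφ : 0 ≤ αφ)
    (hφ : ∀ z₁ z₂ z₃ z₄ : Xφ,
      φ z₁ z₄ - φ z₁ z₃ + φ z₂ z₃ - φ z₂ z₄ ≤ αφ * ‖z₁ - z₂‖ * ‖z₃ - z₄‖)
    -- (A6)
    (j : Xj → ℝ) (hj : LocallyLipschitz j)
    (c₀ c₁ : ℝ) (hc₀ : 0 ≤ c₀) (hc₁ : 0 ≤ c₁)
    (hjsub : ∀ (z : Xj), ∀ ζ ∈ clarkeSubdiff j z, ‖ζ‖ ≤ c₀ + c₁ * ‖z‖)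
    (αj : ℝ) (hαj : 0 ≤ αj)
    (hj2 : ∀ z₁ z₂ : Xj,
      clarkeDeriv j z₁ (z₂ - z₁) + clarkeDeriv j z₂ (z₁ - z₂) ≤ αj * ‖z₁ - z₂‖ ^ 2)
    -- (A7)
    (hsmall : αφ * cφ ^ 2 + αj * cj ^ 2 < mA)
    -- (A8)
    (f : X →L[ℝ] ℝ) :
    ∃! u : X, u ∈ K ∧ ∀ v ∈ K,
      f (v - u) ≤ A u (v - u) + (φ (γφ u) (γφ v) - φ (γφ u) (γφ u))
        + clarkeDeriv j (γj u) (γj v - γj u) := by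

  have hdual (g : X →L[ℝ] ℝ) (v : X) : ConvexOn ℝ Set.univ fun u => g (u - v) := by
    refine ⟨convex_univ, fun x _ y _ a b _ _ hab => le_of_eq ?_⟩
    obtain rfl : b = 1 - a := by linarith
    simp only [map_sub, map_add, map_smul, smul_eq_mul]
    ring
  have key := hrefl.existsUnique_equilibrium hKne hKcl hKcv
    (fun u v => (A u - f) (v - u) + (φ (γφ u) (γφ v) - φ (γφ u) (γφ u))
        + clarkeDeriv j (γj u) (γj v - γj u)) (fun v => by simp [clarkeDeriv_zero_right])
    (fun v => ?_) (fun v => ?_) (fun v => ?_) (sub_pos.2 hsmall) (fun u v => ?_)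
  · refine (existsUnique_congr fun u => and_congr_right fun _ => forall₂_congr fun v _ => ?_).1 key
    rw [sub_apply]
    constructor <;> intro h <;> linarith
  · refine ((hdual _ _).add ?_).add ?_
    · simp only [sub_eq_add_neg]
      exact ((hφcv (γφ v)).comp_linearMap γφ.toLinearMap).add_const (-φ (γφ v) (γφ v))
    · simp only [← map_sub]
      have h := ((hj.convexOn_clarkeDeriv (γj v)).comp_linearMap γj.toLinearMap).translate_left (-v)
      simpa [Function.comp_def, sub_eq_add_neg] using h
  · have h1 : LowerSemicontinuous fun u => φ (γφ v) (γφ u) := (hφlsc _).comp γφ.continuous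
    have h2 : Continuous fun u => clarkeDeriv j (γj v) (γj u - γj v) :=
      (hj.continuous_clarkeDeriv (γj v)).comp (by fun_prop)
    have h3 : Continuous fun u => (A v - f) (u - v) := by fun_prop
    have h4 := h1.add (continuous_const (y := -φ (γφ v) (γφ v))).lowerSemicontinuous
    simp only [sub_eq_add_neg (φ _ _)]
    exact (h3.lowerSemicontinuous.add h4).add h2.lowerSemicontinuous
  · have h1 := hA.upperSemicontinuous_apply_sub v
    have h2 : Continuous fun u => -f (v - u) := by fun_prop
    have h3 : UpperSemicontinuous fun u => φ (γφ u) (γφ v) - φ (γφ u) (γφ u) :=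
      (upperSemicontinuous_sub_diag hφlsc hφ (γφ v)).comp γφ.continuous
    have h4 : UpperSemicontinuous fun u => clarkeDeriv j (γj u) (γj v - γj u) :=
      hj.upperSemicontinuous_clarkeDeriv.comp
        (g := fun u => (γj u, γj v - γj u)) (by fun_prop)
    simp only [sub_apply, sub_eq_add_neg (A _ _)]
    exact ((h1.add h2.upperSemicontinuous).add h3).add h4
  · have h1 := hAsm u v
    have h2 := hφ (γφ u) (γφ v) (γφ u) (γφ v)
    have h3 := hj2 (γj u) (γj v)
    have h4 := hγφ (u - v)
    have h5 := hγj (u - v)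
    rw [map_sub] at h4 h5
    have h6 : ‖γφ u - γφ v‖ ^ 2 ≤ (cφ * ‖u - v‖) ^ 2 := by gcongr
    have h7 : ‖γj u - γj v‖ ^ 2 ≤ (cj * ‖u - v‖) ^ 2 := by gcongr
    have h8 := mul_le_mul_of_nonneg_left h6 hαφ
    have h9 := mul_le_mul_of_nonneg_left h7 hαj
    simp only [sub_apply, map_sub] at h1 ⊢
    nlinarith
end

section
/- Assume (A1)–(A8) and let P : X → X* be a penalty operator for K. Let u₀ ∈ K, let (Vₙ) be a sequence of finite-dimensional linear subspaces of X, let wₙ ∈ Vₙ ∩ K with wₙ → u₀ strongly in X, let εₙ > 0, and for each n let uₙ ∈ Vₙ satisfy ⟨A uₙ, vʰ − uₙ⟩ + (1/εₙ) ⟨P uₙ, vʰ − uₙ⟩ + φ(γ_φ uₙ, γ_φ vʰ) − φ(γ_φ uₙ, γ_φ uₙ) + j⁰(γ_j uₙ; γ_j vʰ − γ_j uₙ) ≥ ⟨f, vʰ − uₙ⟩ for all vʰ ∈ Vₙ. Then there exists a constant M > 0 such that ‖uₙ‖_X ≤ M for all n. -/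
open Filter Topology Bornology

/-- A real-valued convex lower semicontinuous function on a Banach space is continuous. -/
theorem ConvexOn.continuous_of_lowerSemicontinuous {E : Type*} [NormedAddCommGroup E]
    [NormedSpace ℝ E] [CompleteSpace E] {h : E → ℝ} (hc : ConvexOn ℝ Set.univ h)
    (hl : LowerSemicontinuous h) : Continuous h := by
  obtain ⟨n, x, hx⟩ := nonempty_interior_of_iUnion_of_closed
    (f := fun n : ℕ => h ⁻¹' Set.Iic (n : ℝ)) (fun n => hl.isClosed_preimage n)
    (Set.eq_univ_of_forall fun x => Set.mem_iUnion.2 (exists_nat_ge (h x)))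
  have hb : (𝓝 x).IsBoundedUnder (· ≤ ·) h :=
    ⟨n, eventually_map.2 (mem_interior_iff_mem_nhds.1 hx)⟩
  have htfae := hc.continuousOn_tfae isOpen_univ Set.univ_nonempty
  exact continuousOn_univ.1 ((htfae.out 3 1 :).1 ⟨x, Set.mem_univ x, hb⟩)

/-- The Clarke derivative of a function that is `L`-Lipschitz near `x` is at least `-L ‖v‖` in the
direction `v`. -/
theorem neg_mul_norm_le_clarkeDeriv {Y : Type*} [NormedAddCommGroup Y] [NormedSpace ℝ Y]
    {ψ : Y → ℝ} {L : NNReal} {t : Set Y} {x : Y} (hL : LipschitzOnWith L ψ t) (ht : t ∈ 𝓝 x)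
    (v : Y) : -(L * ‖v‖) ≤ clarkeDeriv ψ x v := by
  have hx : ∀ᶠ p : Y × ℝ in 𝓝 x ×ˢ 𝓝[>] (0 : ℝ), p.1 ∈ t := tendsto_fst ht
  have hpos : ∀ᶠ p : Y × ℝ in 𝓝 x ×ˢ 𝓝[>] (0 : ℝ), 0 < p.2 := tendsto_snd self_mem_nhdsWithin
  have hshift : ∀ᶠ p : Y × ℝ in 𝓝 x ×ˢ 𝓝[>] (0 : ℝ), p.1 + p.2 • v ∈ t := by
    have hcont : Tendsto (fun p : Y × ℝ => p.1 + p.2 • v) (𝓝 (x, 0)) (𝓝 x) := by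
      have : Continuous fun p : Y × ℝ => p.1 + p.2 • v := by fun_prop
      simpa using this.tendsto (x, 0)
    rw [nhds_prod_eq] at hcont
    exact hcont.mono_left (prod_mono le_rfl nhdsWithin_le_nhds) ht
  have habs : ∀ᶠ p : Y × ℝ in 𝓝 x ×ˢ 𝓝[>] (0 : ℝ),
      |(ψ (p.1 + p.2 • v) - ψ p.1) / p.2| ≤ L * ‖v‖ := by
    filter_upwards [hx, hpos, hshift] with p h1 h2 h3
    have := hL.dist_le_mul _ h3 _ h1
    rw [Real.dist_eq, dist_eq_norm, add_sub_cancel_left, norm_smul, Real.norm_of_nonneg h2.le]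
      at this
    rw [abs_div, abs_of_pos h2, div_le_iff₀ h2]
    linarith
  exact le_limsup_of_frequently_le (habs.mono fun p hp => (abs_le.1 hp).1).frequently
    ⟨_, eventually_map.2 (habs.mono fun p hp => (abs_le.1 hp).2)⟩

/-- Proposition: uniform boundedness: under (A1)–(A8), solutions of the
discrete penalized problems are uniformly bounded. -/
theorem penalized_discrete_solutions_bounded
    {X Xφ Xj : Type*}
    [NormedAddCommGroup X] [NormedSpace ℝ X] [CompleteSpace X]
    [NormedAddCommGroup Xφ] [NormedSpace ℝ Xφ] [CompleteSpace Xφ]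
    [NormedAddCommGroup Xj] [NormedSpace ℝ Xj] [CompleteSpace Xj]
    -- (A1)
    (hrefl : IsReflexive X)
    (K : Set X) (hKne : K.Nonempty) (hKcl : IsClosed K) (hKcv : Convex ℝ K)
    -- (A2)
    (γφ : X →L[ℝ] Xφ) (cφ : ℝ) (hcφ : 0 < cφ) (hγφ : ∀ v : X, ‖γφ v‖ ≤ cφ * ‖v‖)
    -- (A3)
    (γj : X →L[ℝ] Xj) (cj : ℝ) (hcj : 0 < cj) (hγj : ∀ v : X, ‖γj v‖ ≤ cj * ‖v‖)
    -- (A4)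
    (A : X → X →L[ℝ] ℝ) (hA : Pseudomonotone A)
    (mA : ℝ) (hmA : 0 < mA)
    (hAsm : ∀ v₁ v₂ : X, mA * ‖v₁ - v₂‖ ^ 2 ≤ (A v₁ - A v₂) (v₁ - v₂))
    -- (A5)
    (φ : Xφ → Xφ → ℝ)
    (hφcv : ∀ z : Xφ, ConvexOn ℝ Set.univ (φ z))
    (hφlsc : ∀ z : Xφ, LowerSemicontinuous (φ z))
    (αφ : ℝ) (hαφ : 0 ≤ αφ)
    (hφ : ∀ z₁ z₂ z₃ z₄ : Xφ,
      φ z₁ z₄ - φ z₁ z₃ + φ z₂ z₃ - φ z₂ z₄ ≤ αφ * ‖z₁ - z₂‖ * ‖z₃ - z₄‖)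
    -- (A6)
    (j : Xj → ℝ) (hj : LocallyLipschitz j)
    (c₀ c₁ : ℝ) (hc₀ : 0 ≤ c₀) (hc₁ : 0 ≤ c₁)
    (hjsub : ∀ (z : Xj), ∀ ζ ∈ clarkeSubdiff j z, ‖ζ‖ ≤ c₀ + c₁ * ‖z‖)
    (αj : ℝ) (hαj : 0 ≤ αj)
    (hj2 : ∀ z₁ z₂ : Xj,
      clarkeDeriv j z₁ (z₂ - z₁) + clarkeDeriv j z₂ (z₁ - z₂) ≤ αj * ‖z₁ - z₂‖ ^ 2)
    -- (A7)
    (hsmall : αφ * cφ ^ 2 + αj * cj ^ 2 < mA)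
    -- (A8)
    (f : X →L[ℝ] ℝ)
    -- penalty operator
    (P : X → X →L[ℝ] ℝ) (hP : IsPenaltyOperator P K)
    -- data of the statement
    (u₀ : X) (hu₀ : u₀ ∈ K)
    (V : ℕ → Submodule ℝ X) (hV : ∀ n, FiniteDimensional ℝ (V n))
    (w : ℕ → X) (hwV : ∀ n, w n ∈ V n) (hwK : ∀ n, w n ∈ K)
    (hw : Tendsto w atTop (𝓝 u₀))
    (ε : ℕ → ℝ) (hε : ∀ n, 0 < ε n)
    (u : ℕ → X) (huV : ∀ n, u n ∈ V n)
    (hu : ∀ n, ∀ vh ∈ V n,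
      f (vh - u n) ≤ A (u n) (vh - u n) + (1 / ε n) * P (u n) (vh - u n)
        + (φ (γφ (u n)) (γφ vh) - φ (γφ (u n)) (γφ (u n)))
        + clarkeDeriv j (γj (u n)) (γj vh - γj (u n))) :
    ∃ M : ℝ, 0 < M ∧ ∀ n, ‖u n‖ ≤ M := by
  obtain ⟨-, -, hPmono, hPker⟩ := hP
  obtain ⟨Ca, hCa⟩ := (hA.1 _ (Metric.isBounded_range_of_tendsto w hw)).exists_norm_le
  obtain ⟨L, t, ht, hL⟩ := hj (γj u₀)
  have hcont := (hφcv (γφ u₀)).continuous_of_lowerSemicontinuous (hφlsc (γφ u₀))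
  obtain ⟨l, c, hlc, -⟩ := (hφcv (γφ u₀)).exists_affine_le_of_lt (𝕜 := ℝ)
    (Set.mem_univ (γφ u₀)) (sub_one_lt _) isClosed_univ ((hφlsc _).lowerSemicontinuousOn _)
  have ev₁ : ∀ᶠ n in atTop, ‖w n - u₀‖ < 1 := by
    simpa [dist_eq_norm] using Metric.tendsto_nhds.1 hw 1 one_pos
  have ev₂ : ∀ᶠ n in atTop, φ (γφ u₀) (γφ (w n)) < φ (γφ u₀) (γφ u₀) + 1 :=
    ((hcont.tendsto _).comp ((γφ.continuous.tendsto _).comp hw)).eventually_lt_const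
      (lt_add_one _)
  have ev₃ : ∀ᶠ n in atTop, γj (w n) ∈ interior t :=
    ((γj.continuous.tendsto _).comp hw) (interior_mem_nhds.2 ht)
  set δ := mA - (αφ * cφ ^ 2 + αj * cj ^ 2) with hδ
  have hδpos : 0 < δ := sub_pos.2 hsmall
  set C₁ := ‖f‖ + Ca + αφ * cφ ^ 2 + L * cj + ‖l‖ * cφ with hC₁
  set C₂ := φ (γφ u₀) (γφ u₀) + 1 - c + ‖l‖ * cφ * (‖u₀‖ + 1) with hC₂
  have hbdd : IsBoundedUnder (· ≤ ·) atTop fun n => ‖u n‖ := by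
    refine ⟨max 1 ((C₁ + |C₂|) / δ) + (‖u₀‖ + 1), eventually_map.2 ?_⟩
    filter_upwards [ev₁, ev₂, ev₃] with n h₁ h₂ h₃
    set r := ‖u n - w n‖ with hr
    have hr0 : 0 ≤ r := norm_nonneg _
    have hw_norm : ‖w n‖ ≤ ‖u₀‖ + 1 := by
      have := norm_le_norm_add_norm_sub u₀ (w n)
      rw [norm_sub_rev] at h₁
      linarith
    have hu_norm : ‖u n‖ ≤ r + (‖u₀‖ + 1) := by
      have := norm_add_le (u n - w n) (w n)
      rw [sub_add_cancel] at this
      linarith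
    have hPw : P (w n) = 0 := by
      have := hwK n
      rwa [← hPker] at this
    have hPle : (1 / ε n) * P (u n) (w n - u n) ≤ 0 := by
      have := hPmono (u n) (w n)
      rw [hPw, sub_zero, ← neg_sub, map_neg] at this
      exact mul_nonpos_of_nonneg_of_nonpos (one_div_pos.2 (hε n)).le (by linarith)
    have hAle : A (u n) (w n - u n) ≤ Ca * r - mA * r ^ 2 := by
      have h := hAsm (u n) (w n)
      have hle := (A (w n)).le_of_opNorm_le (hCa _ ⟨w n, ⟨n, rfl⟩, rfl⟩) (u n - w n)
      have := (abs_le.1 (Real.norm_eq_abs _ ▸ hle)).1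
      rw [sub_apply] at h
      rw [← neg_sub, map_neg]
      linarith
    have hf : -(‖f‖ * r) ≤ f (w n - u n) := by
      have hle := f.le_opNorm (w n - u n)
      rw [norm_sub_rev] at hle
      exact (abs_le.1 (Real.norm_eq_abs _ ▸ hle)).1
    have hφle : φ (γφ (u n)) (γφ (w n)) - φ (γφ (u n)) (γφ (u n))
        ≤ αφ * cφ ^ 2 * (r + 1) * r + (φ (γφ u₀) (γφ (w n)) - φ (γφ u₀) (γφ (u n))) := by
      have h := hφ (γφ (u n)) (γφ u₀) (γφ (u n)) (γφ (w n))
      rw [← map_sub, ← map_sub] at h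
      have hu₀_norm : ‖u n - u₀‖ ≤ r + 1 := by
        have := norm_sub_le_norm_sub_add_norm_sub (u n) (w n) u₀
        linarith
      have ha : ‖γφ (u n - u₀)‖ ≤ cφ * (r + 1) :=
        (hγφ _).trans (mul_le_mul_of_nonneg_left hu₀_norm hcφ.le)
      have : αφ * ‖γφ (u n - u₀)‖ * ‖γφ (u n - w n)‖ ≤ αφ * (cφ * (r + 1)) * (cφ * r) := by
        gcongr
        exact hγφ _
      linarith
    have hl : -(‖l‖ * cφ * (r + (‖u₀‖ + 1))) + c ≤ φ (γφ u₀) (γφ (u n)) := by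
      have hle : l (γφ (u n)) + c ≤ φ (γφ u₀) (γφ (u n)) := hlc ⟨γφ (u n), Set.mem_univ _⟩
      have hb : |l (γφ (u n))| ≤ ‖l‖ * cφ * (r + (‖u₀‖ + 1)) := by
        rw [mul_assoc]
        exact (l.le_opNorm _).trans (mul_le_mul_of_nonneg_left
          ((hγφ _).trans (mul_le_mul_of_nonneg_left hu_norm hcφ.le)) (norm_nonneg _))
      linarith [(abs_le.1 hb).1]
    have hjle : clarkeDeriv j (γj (u n)) (γj (w n) - γj (u n))
        ≤ αj * cj ^ 2 * r ^ 2 + L * cj * r := by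
      have h := hj2 (γj (u n)) (γj (w n))
      have hlow := neg_mul_norm_le_clarkeDeriv hL (mem_interior_iff_mem_nhds.1 h₃)
        (γj (u n) - γj (w n))
      rw [← map_sub γj (u n)] at h hlow
      have h1 : αj * ‖γj (u n - w n)‖ ^ 2 ≤ αj * (cj * r) ^ 2 := by
        gcongr
        exact hγj _
      have h2 : L * ‖γj (u n - w n)‖ ≤ L * (cj * r) := by
        gcongr
        exact hγj _
      linarith
    have key : δ * r ^ 2 ≤ C₁ * r + C₂ := by
      have := hu n (w n) (hwV n)
      rw [hδ, hC₁, hC₂]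
      linarith
    have hrle : r ≤ max 1 ((C₁ + |C₂|) / δ) := by
      rcases le_total r 1 with h | h
      · exact le_max_of_le_left h
      · refine le_max_of_le_right ((le_div_iff₀ hδpos).2 ?_)
        have hmul : |C₂| ≤ |C₂| * r := le_mul_of_one_le_right (abs_nonneg _) h
        have : r * δ * r ≤ (C₁ + |C₂|) * r := by linarith [le_abs_self C₂]
        exact le_of_mul_le_mul_right this (by linarith)
    linarith
  obtain ⟨M, hM⟩ := hbdd.bddAbove_range
  exact ⟨max M 1, lt_max_of_lt_right one_pos,
    fun n => le_max_of_le_left (hM ⟨n, rfl⟩)⟩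
end

section
/- Assume (A1), (A3), (A4), (A6), (A7)' (α_j c_j² < m_A), (A8), and (A10)' (γ_j is a compact operator), let P : X → X* be a penalty operator for K, and let u ∈ K be the unique solution of the constrained hemivariational inequality: ⟨A u, v − u⟩ + j⁰(γ_j u; γ_j v − γ_j u) ≥ ⟨f, v − u⟩ for all v ∈ K. Let (εₙ) be a sequence of positive numbers with εₙ → 0, and let (Vₙ) be a sequence of finite-dimensional linear subspaces of X satisfying (A9): for every v ∈ X there exist vₙ ∈ Vₙ with vₙ → v strongly in X, and for every v ∈ K there exist vₙ ∈ Vₙ ∩ K with vₙ → v strongly in X. For each n, let uₙ ∈ Vₙ satisfy ⟨A uₙ, vʰ − uₙ⟩ + (1/εₙ) ⟨P uₙ, vʰ − uₙ⟩ + j⁰(γ_j uₙ; γ_j vʰ − γ_j uₙ) ≥ ⟨f, vʰ − uₙ⟩ for all vʰ ∈ Vₙ. Then uₙ → u strongly in X as n → ∞. -/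
open Filter Topology Bornology

section ClarkeDerivative

variable {Y : Type*} [NormedAddCommGroup Y] [NormedSpace ℝ Y] {ψ : Y → ℝ}

/-- Near any point, the difference quotients of a locally Lipschitz function are uniformly
Lipschitz in the direction. -/
lemma LocallyLipschitz.exists_abs_diffQuot_sub_le (hψ : LocallyLipschitz ψ) (x : Y) :
    ∃ L : ℝ, 0 ≤ L ∧ ∀ᶠ z in 𝓝 x, ∀ v w : Y, ∀ᶠ p in (𝓝 z) ×ˢ (𝓝[>] (0 : ℝ)),
      |(ψ (p.1 + p.2 • v) - ψ p.1) / p.2 - (ψ (p.1 + p.2 • w) - ψ p.1) / p.2|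
        ≤ L * ‖v - w‖ := by
  obtain ⟨L, s, hs, hL⟩ := hψ x
  refine ⟨L, L.2, ?_⟩
  filter_upwards [eventually_mem_nhds_iff.2 hs] with z hz v w
  have hmem : ∀ v : Y, ∀ᶠ p : Y × ℝ in (𝓝 z) ×ˢ (𝓝[>] (0 : ℝ)), p.1 + p.2 • v ∈ s := by
    intro v
    have hc : Tendsto (fun p : Y × ℝ => p.1 + p.2 • v) (𝓝 (z, 0)) (𝓝 z) := by
      have : Continuous (fun p : Y × ℝ => p.1 + p.2 • v) := by fun_prop
      simpa using this.tendsto (z, (0 : ℝ))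
    rw [nhds_prod_eq] at hc
    exact (hc.mono_left (Filter.prod_mono le_rfl nhdsWithin_le_nhds)).eventually hz
  have hpos : ∀ᶠ p : Y × ℝ in (𝓝 z) ×ˢ (𝓝[>] (0 : ℝ)), 0 < p.2 :=
    (tendsto_snd (f := 𝓝 z) (g := 𝓝[>] (0 : ℝ))).eventually self_mem_nhdsWithin
  filter_upwards [hmem v, hmem w, hpos] with p h1 h2 hp
  have hd := hL.dist_le_mul _ h1 _ h2
  rw [Real.dist_eq, dist_eq_norm, add_sub_add_left_eq_sub, ← smul_sub, norm_smul,
    Real.norm_of_nonneg hp.le] at hd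
  rw [← sub_div, sub_sub_sub_cancel_right, abs_div, abs_of_pos hp, div_le_iff₀ hp]
  linarith

/-- Locally uniform bound on the Clarke derivative, together with the boundedness of the
difference quotients which makes its defining `limsup` meaningful. -/
lemma LocallyLipschitz.exists_abs_diffQuot_le (hψ : LocallyLipschitz ψ) (x : Y) :
    ∃ L : ℝ, 0 ≤ L ∧ ∀ᶠ z in 𝓝 x, ∀ v : Y, ∀ᶠ p in (𝓝 z) ×ˢ (𝓝[>] (0 : ℝ)),
      |(ψ (p.1 + p.2 • v) - ψ p.1) / p.2| ≤ L * ‖v‖ := by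
  obtain ⟨L, hL0, hL⟩ := hψ.exists_abs_diffQuot_sub_le x
  exact ⟨L, hL0, hL.mono fun z hz v => (hz v 0).mono fun p hp => by simpa using hp⟩

lemma LocallyLipschitz.isBoundedUnder_diffQuot (hψ : LocallyLipschitz ψ) (x v : Y) :
    IsBoundedUnder (· ≤ ·) ((𝓝 x) ×ˢ (𝓝[>] (0 : ℝ)))
      (fun p : Y × ℝ => (ψ (p.1 + p.2 • v) - ψ p.1) / p.2) := by
  obtain ⟨L, -, hL⟩ := hψ.exists_abs_diffQuot_le x
  exact isBoundedUnder_of_eventually_le (a := L * ‖v‖)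
    ((hL.self_of_nhds v).mono fun p hp => (abs_le.1 hp).2)

lemma LocallyLipschitz.isCoboundedUnder_diffQuot (hψ : LocallyLipschitz ψ) (x v : Y) :
    IsCoboundedUnder (· ≤ ·) ((𝓝 x) ×ˢ (𝓝[>] (0 : ℝ)))
      (fun p : Y × ℝ => (ψ (p.1 + p.2 • v) - ψ p.1) / p.2) := by
  obtain ⟨L, -, hL⟩ := hψ.exists_abs_diffQuot_le x
  exact (isBoundedUnder_of_eventually_ge (a := -(L * ‖v‖))
    ((hL.self_of_nhds v).mono fun p hp => (abs_le.1 hp).1)).isCoboundedUnder_le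

/-- The Clarke derivative is, locally uniformly in the base point, bounded below by a multiple
of the norm of the direction. -/
lemma LocallyLipschitz.exists_neg_le_clarkeDeriv (hψ : LocallyLipschitz ψ) (x : Y) :
    ∃ L : ℝ, 0 ≤ L ∧ ∀ᶠ z in 𝓝 x, ∀ v : Y, -(L * ‖v‖) ≤ clarkeDeriv ψ z v := by
  obtain ⟨L, hL0, hL⟩ := hψ.exists_abs_diffQuot_le x
  refine ⟨L, hL0, hL.mono fun z hz v => ?_⟩
  exact le_limsup_of_frequently_le ((hz v).mono fun p hp => (abs_le.1 hp).1).frequently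
    (hψ.isBoundedUnder_diffQuot z v)

/-- The Clarke derivative is upper semicontinuous jointly in the point and the direction. -/
lemma LocallyLipschitz.eventually_clarkeDeriv_lt (hψ : LocallyLipschitz ψ) {x v : Y} {c : ℝ}
    (hc : clarkeDeriv ψ x v < c) :
    ∀ᶠ q in (𝓝 x) ×ˢ (𝓝 v), clarkeDeriv ψ q.1 q.2 < c := by
  obtain ⟨d, hd, hdc⟩ := exists_between hc
  obtain ⟨L, hL0, hL⟩ := hψ.exists_abs_diffQuot_sub_le x
  have hlt := eventually_lt_of_limsup_lt hd (hψ.isBoundedUnder_diffQuot x v)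
  obtain ⟨pa, hpa, pb, hpb, hab⟩ := eventually_prod_iff.1 hlt
  have hv : ∀ᶠ v' in 𝓝 v, d + L * ‖v' - v‖ < c := by
    have hcont : Continuous fun v' : Y => d + L * ‖v' - v‖ := by fun_prop
    exact hcont.continuousAt.eventually_lt continuousAt_const (by simpa using hdc)
  filter_upwards [(hL.and hpa.eventually_nhds).prod_mk hv] with q hq
  obtain ⟨⟨hq1, hq2⟩, hq3⟩ := hq
  refine lt_of_le_of_lt ?_ hq3
  refine limsup_le_of_le (hψ.isCoboundedUnder_diffQuot q.1 q.2) ?_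
  filter_upwards [hq1 q.2 v, hq2.prod_mk hpb] with p hp1 hp2
  have := hab hp2.1 hp2.2
  have := (abs_le.1 hp1).2
  simp only at *
  linarith

end ClarkeDerivative

section WeakLimits

variable {X : Type*} [NormedAddCommGroup X] [NormedSpace ℝ X]

/-- In a reflexive space, a bounded family has a weak limit along every ultrafilter. -/
lemma IsReflexive.exists_weak_limit (hrefl : IsReflexive X) {ι : Type*} (U : Ultrafilter ι)
    {x : ι → X} {R : ℝ} (hx : ∀ᶠ i in (U : Filter ι), ‖x i‖ ≤ R) :
    ∃ w : X, ∀ g : X →L[ℝ] ℝ, Tendsto (fun i => g (x i)) U (𝓝 (g w)) := by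
  let F : ι → WeakDual ℝ (StrongDual ℝ X) := fun i =>
    StrongDual.toWeakDual (NormedSpace.inclusionInDoubleDual ℝ X (x i))
  have hcpt := WeakDual.isCompact_closedBall (𝕜 := ℝ) (E := StrongDual ℝ X) 0 R
  have hmem : ∀ᶠ i in (U : Filter ι), F i ∈ WeakDual.toStrongDual ⁻¹' Metric.closedBall 0 R := by
    filter_upwards [hx] with i hi
    exact (dist_zero_right (NormedSpace.inclusionInDoubleDual ℝ X (x i))).trans_le
      ((NormedSpace.double_dual_bound ℝ X (x i)).trans hi)
  obtain ⟨φ, -, hφ⟩ := hcpt.ultrafilter_le_nhds (U.map F) (le_principal_iff.2 hmem)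
  obtain ⟨w, hw⟩ := hrefl (WeakDual.toStrongDual φ)
  refine ⟨w, fun g => ?_⟩
  have h1 : Tendsto (fun i => F i g) U (𝓝 (φ g)) :=
    ((WeakDual.eval_continuous g).tendsto φ).comp hφ
  have h2 : φ g = g w := by
    have := congrArg (fun ξ : StrongDual ℝ (StrongDual ℝ X) => ξ g) hw
    simpa using this.symm
  rw [← h2]
  exact h1

/-- A compact operator turns weak convergence of bounded families along an ultrafilter into
strong convergence. -/
lemma IsCompactOperator.tendsto_of_weak {Z : Type*} [NormedAddCommGroup Z] [NormedSpace ℝ Z]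
    {T : X →L[ℝ] Z} (hT : IsCompactOperator T) {ι : Type*} (U : Ultrafilter ι)
    {x : ι → X} {R : ℝ} (hx : ∀ᶠ i in (U : Filter ι), ‖x i‖ ≤ R) {w : X}
    (hw : ∀ g : X →L[ℝ] ℝ, Tendsto (fun i => g (x i)) U (𝓝 (g w))) :
    Tendsto (fun i => T (x i)) U (𝓝 (T w)) := by
  have hcpt : IsCompact (closure (T '' Metric.closedBall 0 R)) :=
    IsCompactOperator.isCompact_closure_image_closedBall (f := T.toLinearMap) hT R
  have hmem : ∀ᶠ i in (U : Filter ι), T (x i) ∈ closure (T '' Metric.closedBall 0 R) := by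
    filter_upwards [hx] with i hi
    exact subset_closure ⟨x i, by simpa using hi, rfl⟩
  obtain ⟨z, -, hz⟩ := hcpt.ultrafilter_le_nhds (U.map fun i => T (x i))
    (le_principal_iff.2 hmem)
  have hz' : Tendsto (fun i => T (x i)) U (𝓝 z) := hz
  have : z = T w := by
    refine (SeparatingDual.eq_iff_forall_dual_eq (R := ℝ)).2 fun g => ?_
    exact tendsto_nhds_unique ((g.continuous.tendsto z).comp hz') (hw (g.comp T))
  rwa [← this]

/-- Weak lower semicontinuity of the norm along a filter. -/
lemma norm_le_of_weak_limit {ι : Type*} {l : Filter ι} [l.NeBot] {x : ι → X} {w : X} {a : ℝ}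
    (hw : ∀ g : X →L[ℝ] ℝ, Tendsto (fun i => g (x i)) l (𝓝 (g w)))
    (hx : Tendsto (fun i => ‖x i‖) l (𝓝 a)) : ‖w‖ ≤ a := by
  obtain ⟨g, hg, hgw⟩ := exists_dual_vector'' ℝ w
  have hgw' : g w = ‖w‖ := by simpa using hgw
  rw [← hgw']
  refine le_of_tendsto_of_tendsto (hw g) hx (Eventually.of_forall fun i => ?_)
  calc g (x i) ≤ ‖g (x i)‖ := Real.le_norm_self _
    _ ≤ 1 * ‖x i‖ := g.le_of_opNorm_le hg _
    _ = ‖x i‖ := one_mul _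

/-- A bounded operator has uniformly bounded values on a ball. -/
lemma BoundedOperator.exists_norm_le {A : X → X →L[ℝ] ℝ} (hA : BoundedOperator A) (R : ℝ) :
    ∃ M : ℝ, 0 ≤ M ∧ ∀ v : X, ‖v‖ ≤ R → ‖A v‖ ≤ M := by
  obtain ⟨M, hM⟩ := (hA (Metric.closedBall 0 R) Metric.isBounded_closedBall).exists_norm_le
  exact ⟨max M 0, le_max_right _ _, fun v hv =>
    (hM _ ⟨v, by simpa using hv, rfl⟩).trans (le_max_left _ _)⟩

/-- Minty's argument for a penalty operator: a solution of the weak formulation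
`⟨P v, w - v⟩ ≤ 0` for all `v` belongs to the constraint set. -/
lemma IsPenaltyOperator.mem_of_forall_le {P : X → X →L[ℝ] ℝ} {K : Set X}
    (hP : IsPenaltyOperator P K) {w : X} (hw : ∀ v : X, P v (w - v) ≤ 0) : w ∈ K := by
  obtain ⟨-, hdemi, -, hker⟩ := hP
  have hnonneg : ∀ z : X, 0 ≤ P w z := by
    intro z
    have hlim : Tendsto (fun n : ℕ => w + (1 / ((n : ℝ) + 1)) • z) atTop (𝓝 w) := by
      simpa using ((tendsto_one_div_add_atTop_nhds_zero_nat (𝕜 := ℝ)).smul_const z).const_add w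
    refine ge_of_tendsto' (hdemi _ _ hlim z) fun n => ?_
    have hn : (0 : ℝ) < 1 / ((n : ℝ) + 1) := by positivity
    have h := hw (w + (1 / ((n : ℝ) + 1)) • z)
    rw [sub_add_cancel_left, map_neg, map_smul, smul_eq_mul] at h
    exact nonneg_of_mul_nonneg_right (by linarith) hn
  rw [← hker]
  ext z
  have h1 := hnonneg z
  have h2 := hnonneg (-z)
  rw [map_neg] at h2
  simp only [zero_apply]
  linarith

end WeakLimits

/-- Corollary: convergence of the penalty based numerical method for the
constrained hemivariational inequality: under (A1), (A3), (A4), (A6), (A7)', (A8),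
(A9), (A10)', the discrete penalized solutions converge strongly to `u`. -/
theorem hvi_penalized_numerical_convergence
    {X Xj : Type*}
    [NormedAddCommGroup X] [NormedSpace ℝ X] [CompleteSpace X]
    [NormedAddCommGroup Xj] [NormedSpace ℝ Xj] [CompleteSpace Xj]
    -- (A1)
    (hrefl : IsReflexive X)
    (K : Set X) (hKne : K.Nonempty) (hKcl : IsClosed K) (hKcv : Convex ℝ K)
    -- (A3)
    (γj : X →L[ℝ] Xj) (cj : ℝ) (hcj : 0 < cj) (hγj : ∀ v : X, ‖γj v‖ ≤ cj * ‖v‖)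
    -- (A4)
    (A : X → X →L[ℝ] ℝ) (hA : Pseudomonotone A)
    (mA : ℝ) (hmA : 0 < mA)
    (hAsm : ∀ v₁ v₂ : X, mA * ‖v₁ - v₂‖ ^ 2 ≤ (A v₁ - A v₂) (v₁ - v₂))
    -- (A6)
    (j : Xj → ℝ) (hj : LocallyLipschitz j)
    (c₀ c₁ : ℝ) (hc₀ : 0 ≤ c₀) (hc₁ : 0 ≤ c₁)
    (hjsub : ∀ (z : Xj), ∀ ζ ∈ clarkeSubdiff j z, ‖ζ‖ ≤ c₀ + c₁ * ‖z‖)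
    (αj : ℝ) (hαj : 0 ≤ αj)
    (hj2 : ∀ z₁ z₂ : Xj,
      clarkeDeriv j z₁ (z₂ - z₁) + clarkeDeriv j z₂ (z₁ - z₂) ≤ αj * ‖z₁ - z₂‖ ^ 2)
    -- (A7)'
    (hsmall : αj * cj ^ 2 < mA)
    -- (A8)
    (f : X →L[ℝ] ℝ)
    -- (A10)'
    (hγjcpt : IsCompactOperator γj)
    -- penalty operator
    (P : X → X →L[ℝ] ℝ) (hP : IsPenaltyOperator P K)
    -- the solution of the constrained hemivariational inequality
    (u : X) (huK : u ∈ K)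
    (hu : ∀ v ∈ K,
      f (v - u) ≤ A u (v - u) + clarkeDeriv j (γj u) (γj v - γj u))
    -- penalty parameters
    (ε : ℕ → ℝ) (hε : ∀ n, 0 < ε n) (hε0 : Tendsto ε atTop (𝓝 0))
    -- (A9)
    (V : ℕ → Submodule ℝ X) (hV : ∀ n, FiniteDimensional ℝ (V n))
    (hA9X : ∀ v : X, ∃ vh : ℕ → X, (∀ n, vh n ∈ V n) ∧ Tendsto vh atTop (𝓝 v))
    (hA9K : ∀ v ∈ K, ∃ vh : ℕ → X, (∀ n, vh n ∈ V n ∧ vh n ∈ K) ∧ Tendsto vh atTop (𝓝 v))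
    -- the discrete penalized solutions
    (un : ℕ → X) (hunV : ∀ n, un n ∈ V n)
    (hun : ∀ n, ∀ vh ∈ V n,
      f (vh - un n) ≤ A (un n) (vh - un n) + (1 / ε n) * P (un n) (vh - un n)
        + clarkeDeriv j (γj (un n)) (γj vh - γj (un n))) :
    Tendsto un atTop (𝓝 u) := by
  obtain ⟨hAbd, -⟩ := hA
  have hPpen := hP
  obtain ⟨hPbd, -, hPmono, hPker⟩ := hP
  have hPzero : ∀ v ∈ K, P v = 0 := fun v hv => by rw [← hPker] at hv; exact hv
  have htest : ∀ n, ∀ v ∈ V n, v ∈ K →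
      A (un n) (un n - v) ≤ clarkeDeriv j (γj (un n)) (γj v - γj (un n)) + f (un n - v) := by
    intro n v hvV hvK
    have h1 := hun n v hvV
    have h2 := hPmono (un n) v
    rw [hPzero v hvK, sub_zero] at h2
    have h3 : (1 / ε n) * P (un n) (v - un n) ≤ 0 := by
      rw [← neg_sub, map_neg]
      have := hε n
      have : 0 ≤ (1 / ε n) * P (un n) (un n - v) := by positivity
      linarith
    have h4 : f (v - un n) = -f (un n - v) := by rw [← map_neg, neg_sub]
    have h5 : A (un n) (v - un n) = -A (un n) (un n - v) := by rw [← map_neg, neg_sub]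
    linarith
  obtain ⟨vh, hvh, hvhlim⟩ := hA9K u huK
  obtain ⟨R, hR⟩ : ∃ R : ℝ, ∀ᶠ n in atTop, ‖un n‖ ≤ R := by
    obtain ⟨Rv, hRv⟩ := (Metric.isBounded_range_of_tendsto vh hvhlim).exists_norm_le
    obtain ⟨M, hM0, hM⟩ := hAbd.exists_norm_le Rv
    obtain ⟨L, hL0, hL⟩ := hj.exists_neg_le_clarkeDeriv (γj u)
    refine ⟨(‖f‖ + M + L * cj) / (mA - αj * cj ^ 2) + Rv, ?_⟩
    filter_upwards [((γj.continuous.tendsto u).comp hvhlim).eventually hL] with n hn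
    have hvR : ‖vh n‖ ≤ Rv := hRv _ ⟨n, rfl⟩
    have h1 := htest n (vh n) (hvh n).1 (hvh n).2
    have h2 := hAsm (un n) (vh n)
    rw [sub_apply] at h2
    have h3 := hj2 (γj (un n)) (γj (vh n))
    have h4 := hn (γj (un n) - γj (vh n))
    simp only [Function.comp_apply] at h4
    have h5 : ‖γj (un n) - γj (vh n)‖ ≤ cj * ‖un n - vh n‖ := by
      rw [← map_sub]; exact hγj _
    have h6 : ‖γj (un n) - γj (vh n)‖ ^ 2 ≤ (cj * ‖un n - vh n‖) ^ 2 := by gcongr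
    have h7 : f (un n - vh n) ≤ ‖f‖ * ‖un n - vh n‖ :=
      (Real.le_norm_self _).trans (f.le_opNorm _)
    have h8 : -(A (vh n) (un n - vh n)) ≤ M * ‖un n - vh n‖ :=
      (neg_le_abs _).trans ((A (vh n)).le_of_opNorm_le (hM _ hvR) _)
    have h9 := mul_le_mul_of_nonneg_left h6 hαj
    have h10 := mul_le_mul_of_nonneg_left h5 hL0
    have hδ : 0 < mA - αj * cj ^ 2 := by linarith
    have hr : ‖un n - vh n‖ ≤ (‖f‖ + M + L * cj) / (mA - αj * cj ^ 2) := by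
      rw [le_div_iff₀ hδ]
      rcases (norm_nonneg (un n - vh n)).eq_or_lt with h0 | h0
      · rw [← h0, zero_mul]; positivity
      · refine le_of_mul_le_mul_right ?_ h0
        nlinarith
    calc ‖un n‖ = ‖(un n - vh n) + vh n‖ := by rw [sub_add_cancel]
      _ ≤ ‖un n - vh n‖ + ‖vh n‖ := norm_add_le _ _
      _ ≤ _ := add_le_add hr hvR
  rw [tendsto_iff_ultrafilter]
  intro U hU
  have hRU : ∀ᶠ n in (U : Filter ℕ), ‖un n‖ ≤ R := hU hR
  obtain ⟨w, hw⟩ := hrefl.exists_weak_limit U hRU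
  have hγw := hγjcpt.tendsto_of_weak U hRU hw
  have hwsub : ∀ (y : X) (g : X →L[ℝ] ℝ),
      Tendsto (fun n => g (un n - y)) U (𝓝 (g (w - y))) := by
    intro y g
    simpa only [map_sub] using (hw g).sub_const (g y)
  have hγdir : ∀ {y : ℕ → X} {v : X}, Tendsto y U (𝓝 v) →
      Tendsto (fun n => (γj (un n), γj (y n) - γj (un n))) U
        ((𝓝 (γj w)) ×ˢ (𝓝 (γj v - γj w))) := by
    intro y v hy
    exact hγw.prodMk (((γj.continuous.tendsto v).comp hy).sub hγw)
  obtain ⟨MA, hMA0, hMA⟩ := hAbd.exists_norm_le R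
  obtain ⟨MP, hMP0, hMP⟩ := hPbd.exists_norm_le R
  have hwK : w ∈ K := by
    refine hPpen.mem_of_forall_le fun v => ?_
    obtain ⟨y, hyV, hy⟩ := hA9X v
    obtain ⟨Ry, hRy⟩ := (Metric.isBounded_range_of_tendsto y hy).exists_norm_le
    have hyU : Tendsto y U (𝓝 v) := hy.mono_left hU
    have hclarke := (hγdir hyU).eventually (hj.eventually_clarkeDeriv_lt
      (lt_add_one (clarkeDeriv j (γj w) (γj v - γj w))))
    set C := clarkeDeriv j (γj w) (γj v - γj w) + 1 with hC
    have hbound : Tendsto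
        (fun n => ε n * ((MA + ‖f‖) * (Ry + R) + C) + MP * ‖y n - v‖) U (𝓝 0) := by
      have h1 : Tendsto (fun n => ‖y n - v‖) U (𝓝 0) := by
        simpa using (hyU.sub_const v).norm
      simpa using ((hε0.mono_left hU).mul_const _).add (h1.const_mul MP)
    refine le_of_tendsto_of_tendsto (hwsub v (P v)) hbound ?_
    filter_upwards [hRU, hclarke] with n hn hcl
    have h1 := hun n (y n) (hyV n)
    have hyn : ‖y n - un n‖ ≤ Ry + R :=
      (norm_sub_le _ _).trans (add_le_add (hRy _ ⟨n, rfl⟩) hn)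
    have h2 : A (un n) (y n - un n) ≤ MA * (Ry + R) :=
      (Real.le_norm_self _).trans (((A (un n)).le_of_opNorm_le (hMA _ hn) _).trans
        (by gcongr))
    have h3 : -(f (y n - un n)) ≤ ‖f‖ * (Ry + R) :=
      (neg_le_abs _).trans ((f.le_opNorm _).trans (by gcongr))
    have h4 : (1 / ε n) * P (un n) (un n - y n) ≤ (MA + ‖f‖) * (Ry + R) + C := by
      have h5 : P (un n) (un n - y n) = -(P (un n) (y n - un n)) := by
        rw [← map_neg, neg_sub]
      rw [h5]
      linarith
    have h6 : P (un n) (un n - y n) ≤ ε n * ((MA + ‖f‖) * (Ry + R) + C) := by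
      rw [one_div, inv_mul_le_iff₀ (hε n)] at h4
      exact h4
    have h7 : P (un n) (y n - v) ≤ MP * ‖y n - v‖ :=
      (Real.le_norm_self _).trans ((P (un n)).le_of_opNorm_le (hMP _ hn) _)
    have h8 := hPmono (un n) v
    rw [sub_apply] at h8
    have h9 : P (un n) (un n - v) = P (un n) (un n - y n) + P (un n) (y n - v) := by
      rw [← map_add, sub_add_sub_cancel]
    linarith
  have hvhU : Tendsto vh U (𝓝 u) := hvhlim.mono_left hU
  have hRd : ∀ᶠ n in (U : Filter ℕ), ‖un n - u‖ ∈ Set.Icc 0 (R + ‖u‖) := by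
    filter_upwards [hRU] with n hn
    exact ⟨norm_nonneg _, (norm_sub_le _ _).trans (by gcongr)⟩
  obtain ⟨r, hr0, hrlim⟩ := isCompact_Icc.ultrafilter_le_nhds
    (U.map fun n => ‖un n - u‖) (le_principal_iff.2 hRd)
  replace hrlim : Tendsto (fun n => ‖un n - u‖) U (𝓝 r) := hrlim
  have hwr : ‖w - u‖ ≤ r := norm_le_of_weak_limit (hwsub u) hrlim
  have hlimit : mA * r ^ 2 ≤ clarkeDeriv j (γj w) (γj u - γj w) + f (w - u) - A u (w - u) := by
    refine le_of_forall_pos_le_add fun δ hδ => ?_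
    have hclarke := (hγdir hvhU).eventually (hj.eventually_clarkeDeriv_lt
      (lt_add_of_pos_right (clarkeDeriv j (γj w) (γj u - γj w)) hδ))
    have hrhs : Tendsto (fun n => clarkeDeriv j (γj w) (γj u - γj w) + δ
        + f (un n - u) - A u (un n - u) + (MA + ‖f‖) * ‖vh n - u‖) U
        (𝓝 (clarkeDeriv j (γj w) (γj u - γj w) + δ + f (w - u) - A u (w - u)
          + (MA + ‖f‖) * 0)) := by
      have h1 : Tendsto (fun n => ‖vh n - u‖) U (𝓝 0) := by
        simpa using (hvhU.sub_const u).norm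
      exact (((hwsub u f).const_add _).sub (hwsub u (A u))).add (h1.const_mul _)
    have hle := le_of_tendsto_of_tendsto ((hrlim.pow 2).const_mul mA) hrhs (by
      filter_upwards [hRU, hclarke] with n hn hcl
      have h1 := htest n (vh n) (hvh n).1 (hvh n).2
      have h2 := hAsm (un n) u
      rw [sub_apply] at h2
      have h3 : A (un n) (un n - u) = A (un n) (un n - vh n) + A (un n) (vh n - u) := by
        rw [← map_add, sub_add_sub_cancel]
      have h4 : f (un n - u) = f (un n - vh n) + f (vh n - u) := by
        rw [← map_add, sub_add_sub_cancel]
      have h5 : A (un n) (vh n - u) ≤ MA * ‖vh n - u‖ :=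
        (Real.le_norm_self _).trans ((A (un n)).le_of_opNorm_le (hMA _ hn) _)
      have h6 : -(f (vh n - u)) ≤ ‖f‖ * ‖vh n - u‖ :=
        (neg_le_abs _).trans (f.le_opNorm _)
      linarith)
    linarith
  have hγu : ‖γj w - γj u‖ ^ 2 ≤ (cj * ‖w - u‖) ^ 2 := by
    rw [← map_sub]
    gcongr
    exact hγj _
  have hfinal : mA * r ^ 2 ≤ αj * cj ^ 2 * ‖w - u‖ ^ 2 := by
    have h1 := hu w hwK
    have h2 := hj2 (γj w) (γj u)
    have h3 := mul_le_mul_of_nonneg_left hγu hαj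
    linarith
  have hr_zero : r = 0 := by
    have h1 : ‖w - u‖ ^ 2 ≤ r ^ 2 := by gcongr
    have h2 := mul_le_mul_of_nonneg_left h1 (by positivity : 0 ≤ αj * cj ^ 2)
    have h3 : (mA - αj * cj ^ 2) * r ^ 2 ≤ 0 := by linarith
    have h4 : r ^ 2 ≤ 0 := nonpos_of_mul_nonpos_right h3 (by linarith)
    exact pow_eq_zero_iff two_ne_zero |>.1 (le_antisymm h4 (sq_nonneg r))
  rw [hr_zero] at hrlim
  exact tendsto_iff_norm_sub_tendsto_zero.2 hrlim
end
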